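/- Let k ∈ ℕ, let i be a fixed index in Fin n, and let the ranks r(j) for j ≠ i be independent geometric random variables with P(r(j) = m) = 1/2^{m+1}, while r(i) is any fixed value at most k. Let T(r) be the (unique) zip tree on nodes with keys 0, …, n−1 and ranks r. Then the expected total number of nodes on the right spine of the left subtree of node i together with the left spine of the right subtree of node i is at most (3/2)·k + 1/2. -/

import Mathlib

open scoped ENNReal

/-- A binary tree whose nodes carry a key of type `α` and a natural-number rank. -/
inductive ZTree (α : Type) : Type where
  | leaf : ZTree α
  | node (left : ZTree α) (key : α) (rank : ℕ) (right : ZTree α) : ZTree α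

namespace ZTree
variable {α : Type} [LinearOrder α]

/-- The list of (key, rank) pairs of the nodes of the tree, in symmetric order. -/
def nodes : ZTree α → List (α × ℕ)
  | .leaf => []
  | .node l k rk r => l.nodes ++ (k, rk) :: r.nodes

/-- Binary-search-tree (symmetric order) property. -/
def isBST : ZTree α → Prop
  | .leaf => True
  | .node l k _ r =>
      (∀ p ∈ l.nodes, p.1 < k) ∧ (∀ p ∈ r.nodes, k < p.1) ∧ l.isBST ∧ r.isBST

/-- The rank of the root node, if any. -/
def rootRank? : ZTree α → Option ℕ
  | .leaf => none
  | .node _ _ rk _ => some rk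

/-- Max-heap order on ranks, ties broken in favor of smaller keys: every node's rank is
strictly greater than that of its left child and at least that of its right child. -/
def isRankHeap : ZTree α → Prop
  | .leaf => True
  | .node l _ rk r =>
      (∀ m ∈ l.rootRank?, m < rk) ∧ (∀ m ∈ r.rootRank?, m ≤ rk) ∧
        l.isRankHeap ∧ r.isRankHeap

/-- The zip-tree conditions: symmetric order on keys and heap order on ranks. -/
def isZipTree (t : ZTree α) : Prop := t.isBST ∧ t.isRankHeap

/-- The (key, rank) pairs on the search path from the root to the node with key `a`. -/
def pathTo (a : α) : ZTree α → List (α × ℕ)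
  | .leaf => []
  | .node l k rk r =>
      if a < k then (k, rk) :: l.pathTo a
      else if k < a then (k, rk) :: r.pathTo a
      else [(k, rk)]

/-- The depth (number of edges from the root) of the node with key `a`. -/
def depth (a : α) : ZTree α → ℕ
  | .leaf => 0
  | .node l k _ r =>
      if a < k then l.depth a + 1
      else if k < a then r.depth a + 1
      else 0

/-- The subtree rooted at the node with key `a`. -/
def subtreeAt (a : α) : ZTree α → ZTree α
  | .leaf => .leaf
  | .node l k rk r =>
      if a < k then l.subtreeAt a
      else if k < a then r.subtreeAt a
      else .node l k rk r

/-- Number of nodes on the left spine (root through left children). -/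
def leftSpineLen : ZTree α → ℕ
  | .leaf => 0
  | .node l _ _ _ => l.leftSpineLen + 1

/-- Number of nodes on the right spine (root through right children). -/
def rightSpineLen : ZTree α → ℕ
  | .leaf => 0
  | .node _ _ _ r => r.rightSpineLen + 1

/-- Total number of nodes on the right spine of the left subtree of the node with key `a`
together with the left spine of its right subtree: the paths zipped when deleting this
node, equivalently, the path unzipped when inserting it. -/
def zipSpineCount (a : α) (t : ZTree α) : ℕ :=
  match t.subtreeAt a with
  | .leaf => 0
  | .node l _ _ r => l.rightSpineLen + r.leftSpineLen

end ZTree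

namespace ZTree
variable {α : Type}

/-- The root of a rank-heap has maximal rank. -/
lemma isRankHeap.rank_le {t : ZTree α} (ht : t.isRankHeap) {M : ℕ}
    (hM : ∀ m ∈ t.rootRank?, m ≤ M) : ∀ p ∈ t.nodes, p.2 ≤ M := by
  induction t with
  | leaf => simp [nodes]
  | node l k rk r ihl ihr =>
    obtain ⟨h1, h2, h3, h4⟩ := ht
    have hrk : rk ≤ M := hM rk rfl
    intro p hp
    simp only [nodes, List.mem_append, List.mem_cons] at hp
    rcases hp with hp | rfl | hp
    · exact ihl h3 (fun m hm => (h1 m hm).le.trans hrk) p hp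
    · exact hrk
    · exact ihr h4 (fun m hm => (h2 m hm).trans hrk) p hp

lemma isRankHeap.rank_lt {t : ZTree α} (ht : t.isRankHeap) {M : ℕ}
    (hM : ∀ m ∈ t.rootRank?, m < M) : ∀ p ∈ t.nodes, p.2 < M := by
  cases t with
  | leaf => simp [nodes]
  | node l k rk r =>
    intro p hp
    exact (ht.rank_le (M := rk) (by simp [rootRank?]) p hp).trans_lt (hM rk rfl)

variable [LinearOrder α]

/-- Nodes on the right spine are the weak rank records seen from the largest key. -/
lemma isZipTree.rightSpineLen_le {t : ZTree α} (ht : t.isZipTree) :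
    t.rightSpineLen ≤
      (t.nodes.toFinset.filter fun p => ∀ q ∈ t.nodes, p.1 < q.1 → q.2 ≤ p.2).card := by
  induction t with
  | leaf => simp [rightSpineLen]
  | node l k rk r ihl ihr =>
    obtain ⟨⟨b1, b2, b3, b4⟩, h1, h2, h3, h4⟩ := ht
    have hr := h4.rank_le h2
    refine (Nat.add_le_add_right (ihr ⟨b4, h4⟩) 1).trans ?_
    rw [← Finset.card_insert_of_notMem (a := (k, rk))]
    · apply Finset.card_le_card
      intro p hp
      rw [Finset.mem_filter, List.mem_toFinset]
      simp only [Finset.mem_insert, Finset.mem_filter, List.mem_toFinset, nodes,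
        List.mem_append, List.mem_cons] at hp ⊢
      rcases hp with rfl | ⟨hp, hp'⟩
      · refine ⟨by simp, ?_⟩
        rintro q (hq | rfl | hq) hlt
        · exact absurd hlt (b1 q hq).not_gt
        · exact le_rfl
        · exact hr q hq
      · refine ⟨by simp [hp], ?_⟩
        have := b2 p hp
        rintro q (hq | rfl | hq) hlt
        · exact absurd hlt ((b1 q hq).trans this).not_gt
        · exact absurd hlt this.not_gt
        · exact hp' q hq hlt
    · simp only [Finset.mem_filter, List.mem_toFinset, not_and]
      intro hk
      exact absurd (b2 _ hk) (lt_irrefl _)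

/-- Nodes on the left spine are the strict rank records seen from the smallest key. -/
lemma isZipTree.leftSpineLen_le {t : ZTree α} (ht : t.isZipTree) :
    t.leftSpineLen ≤
      (t.nodes.toFinset.filter fun p => ∀ q ∈ t.nodes, q.1 < p.1 → q.2 < p.2).card := by
  induction t with
  | leaf => simp [leftSpineLen]
  | node l k rk r ihl ihr =>
    obtain ⟨⟨b1, b2, b3, b4⟩, h1, h2, h3, h4⟩ := ht
    have hl := h3.rank_lt h1
    refine (Nat.add_le_add_right (ihl ⟨b3, h3⟩) 1).trans ?_
    rw [← Finset.card_insert_of_notMem (a := (k, rk))]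
    · apply Finset.card_le_card
      intro p hp
      rw [Finset.mem_filter, List.mem_toFinset]
      simp only [Finset.mem_insert, Finset.mem_filter, List.mem_toFinset, nodes,
        List.mem_append, List.mem_cons] at hp ⊢
      rcases hp with rfl | ⟨hp, hp'⟩
      · refine ⟨by simp, ?_⟩
        rintro q (hq | rfl | hq) hlt
        · exact hl q hq
        · exact absurd hlt (lt_irrefl _)
        · exact absurd hlt (b2 q hq).not_gt
      · refine ⟨by simp [hp], ?_⟩
        have := b1 p hp
        rintro q (hq | rfl | hq) hlt
        · exact hp' q hq hlt
        · exact absurd hlt this.not_gt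
        · exact absurd hlt (this.trans (b2 q hq)).not_gt
    · simp only [Finset.mem_filter, List.mem_toFinset, not_and]
      intro hk
      exact absurd (b1 _ hk) (lt_irrefl _)

lemma isZipTree.subtreeAt {t : ZTree α} (ht : t.isZipTree) (a : α) :
    (t.subtreeAt a).isZipTree := by
  induction t with
  | leaf => exact ht
  | node l k rk r ihl ihr =>
    have ht' := ht
    obtain ⟨⟨b1, b2, b3, b4⟩, h1, h2, h3, h4⟩ := ht'
    rw [ZTree.subtreeAt]
    split_ifs
    exacts [ihl ⟨b3, h3⟩, ihr ⟨b4, h4⟩, ht]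

lemma nodes_subtreeAt_subset (t : ZTree α) (a : α) : (t.subtreeAt a).nodes ⊆ t.nodes := by
  induction t with
  | leaf => simp [subtreeAt]
  | node l k rk r ihl ihr =>
    rw [subtreeAt]
    intro p hp
    split_ifs at hp
    · simp [nodes, ihl hp]
    · simp [nodes, ihr hp]
    · exact hp

lemma key_of_subtreeAt_eq {t : ZTree α} {a : α} {l r : ZTree α} {k : α} {rk : ℕ}
    (h : t.subtreeAt a = .node l k rk r) : k = a := by
  induction t with
  | leaf => simp [subtreeAt] at h
  | node l' k' rk' r' ihl ihr =>
    rw [subtreeAt] at h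
    split_ifs at h with h1 h2
    · exact ihl h
    · exact ihr h
    · simp only [node.injEq] at h
      exact h.2.1 ▸ le_antisymm (not_lt.1 h1) (not_lt.1 h2)

/-- The keys of the subtree rooted at `a` form an interval of keys. -/
lemma isBST.mem_subtreeAt {t : ZTree α} (ht : t.isBST) {a : α} {p q : α × ℕ}
    (hp : p ∈ (t.subtreeAt a).nodes) (hq : q ∈ t.nodes)
    (hpq : p.1 ≤ q.1 ∧ q.1 ≤ a ∨ a ≤ q.1 ∧ q.1 ≤ p.1) :
    q ∈ (t.subtreeAt a).nodes := by
  induction t with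
  | leaf => simp [nodes] at hq
  | node l k rk r ihl ihr =>
    obtain ⟨b1, b2, b3, b4⟩ := ht
    rw [subtreeAt] at hp ⊢
    simp only [nodes, List.mem_append, List.mem_cons] at hq
    split_ifs at hp ⊢ with h1 h2
    · have hpk := b1 p (nodes_subtreeAt_subset _ _ hp)
      have hqk : q.1 < k := by
        rcases hpq with h | h
        exacts [h.2.trans_lt h1, h.2.trans_lt hpk]
      rcases hq with hq | rfl | hq
      · exact ihl b3 hp hq
      · exact absurd hqk (lt_irrefl _)
      · exact absurd hqk (b2 q hq).not_gt
    · have hpk := b2 p (nodes_subtreeAt_subset _ _ hp)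
      have hqk : k < q.1 := by
        rcases hpq with h | h
        exacts [hpk.trans_le h.1, h2.trans_le h.1]
      rcases hq with hq | rfl | hq
      · exact absurd hqk (b1 q hq).not_gt
      · exact absurd hqk (lt_irrefl _)
      · exact ihr b4 hp hq
    · simpa [nodes] using hq

/-- The zipped paths at `a` consist of rank records seen from `a`: weak records of rank below
that of `a` on the left, strict records of rank at most that of `a` on the right. -/
lemma isZipTree.zipSpineCount_le {t : ZTree α} (ht : t.isZipTree) {a : α} {v : ℕ}
    (hv : ∀ p ∈ t.nodes, p.1 = a → p.2 = v) :
    t.zipSpineCount a ≤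
      (t.nodes.toFinset.filter fun p => p.1 < a ∧ p.2 < v ∧
        ∀ q ∈ t.nodes, p.1 < q.1 → q.1 < a → q.2 ≤ p.2).card +
      (t.nodes.toFinset.filter fun p => a < p.1 ∧ p.2 ≤ v ∧
        ∀ q ∈ t.nodes, a < q.1 → q.1 < p.1 → q.2 < p.2).card := by
  rw [zipSpineCount]
  split
  · exact Nat.zero_le _
  · rename_i l k rk r heq
    obtain rfl := key_of_subtreeAt_eq heq
    have hs := ht.subtreeAt k
    have hsub := nodes_subtreeAt_subset t k
    have hmem := fun {p q} => ht.1.mem_subtreeAt (a := k) (p := p) (q := q)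
    rw [heq] at hs hsub hmem
    obtain ⟨⟨b1, b2, b3, b4⟩, h1, h2, h3, h4⟩ := hs
    obtain rfl : rk = v := hv (k, rk) (hsub (by simp [nodes])) rfl
    have hl := h3.rank_lt h1
    have hr := h4.rank_le h2
    simp only [nodes, List.mem_append, List.mem_cons] at hmem
    refine Nat.add_le_add ((isZipTree.rightSpineLen_le ⟨b3, h3⟩).trans ?_)
      ((isZipTree.leftSpineLen_le ⟨b4, h4⟩).trans ?_)
    · apply Finset.card_le_card
      intro p hp
      simp only [Finset.mem_filter, List.mem_toFinset] at hp ⊢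
      obtain ⟨hp, hp'⟩ := hp
      refine ⟨hsub (by simp [nodes, hp]), b1 p hp, hl p hp, fun q hq hpq hqk => ?_⟩
      rcases hmem (.inl hp) hq (.inl ⟨hpq.le, hqk.le⟩) with h | rfl | h
      · exact hp' q h hpq
      · exact absurd hqk (lt_irrefl _)
      · exact absurd hqk (b2 q h).not_gt
    · apply Finset.card_le_card
      intro p hp
      simp only [Finset.mem_filter, List.mem_toFinset] at hp ⊢
      obtain ⟨hp, hp'⟩ := hp
      refine ⟨hsub (by simp [nodes, hp]), b2 p hp, hr p hp, fun q hq hqk hpq => ?_⟩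
      rcases hmem (.inr (.inr hp)) hq (.inr ⟨hqk.le, hpq.le⟩) with h | rfl | h
      · exact absurd hqk (b1 q h).not_gt
      · exact absurd hqk (lt_irrefl _)
      · exact hp' q h hpq

end ZTree

section Geometric

open MeasureTheory

lemma tsum_half_pow_succ : ∑' m : ℕ, (1 / 2 : ℝ≥0∞) ^ (m + 1) = 1 := by
  rw [ENNReal.tsum_geometric_add_one, one_div, ENNReal.one_sub_inv_two, inv_inv]
  exact ENNReal.inv_mul_cancel (by simp) (by simp)

/-- The geometric distribution of mean `1` on `ℕ`. -/
noncomputable def geomPMF : PMF ℕ :=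
  ⟨fun m => (1 / 2 : ℝ≥0∞) ^ (m + 1), by
    simpa only [tsum_half_pow_succ] using
      (ENNReal.summable (f := fun m : ℕ => (1 / 2 : ℝ≥0∞) ^ (m + 1))).hasSum⟩

lemma geomPMF_apply (m : ℕ) : geomPMF m = (1 / 2 : ℝ≥0∞) ^ (m + 1) := rfl

lemma one_sub_geomPMF_Iio (c : ℕ) :
    1 - geomPMF.toMeasure (Set.Iio c) = (1 / 2 : ℝ≥0∞) ^ c := by
  have h : geomPMF.toMeasure (Set.Iio c) + (1 / 2 : ℝ≥0∞) ^ c = 1 := by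
    rw [← Finset.coe_Iio, PMF.toMeasure_apply_finset]
    simp only [geomPMF_apply, Nat.Iio_eq_range]
    induction c with
    | zero => simp
    | succ c ih =>
      rw [Finset.sum_range_succ, add_assoc, ← two_mul, pow_succ, ← mul_assoc, mul_comm 2,
        mul_assoc, one_div, ENNReal.mul_inv_cancel (by simp) (by simp), mul_one]
      simpa using ih
  exact (ENNReal.eq_sub_of_add_eq' ENNReal.one_ne_top (by rwa [add_comm])).symm

variable {ι : Type*} [Fintype ι]

lemma pi_setOf_eval_eq_and_forall_mem {ν : Measure ℕ} [IsProbabilityMeasure ν]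
    {j : ι} {S : Finset ι} (hj : j ∉ S) (A B : Set ℕ) :
    Measure.pi (fun _ : ι => ν) {g | g j ∈ A ∧ ∀ y ∈ S, g y ∈ B} = ν A * ν B ^ S.card := by
  classical
  have : {g : ι → ℕ | g j ∈ A ∧ ∀ y ∈ S, g y ∈ B} =
      Set.univ.pi fun x => if x = j then A else if x ∈ S then B else Set.univ := by
    ext g
    simp only [Set.mem_ofPred_eq, Set.mem_pi, Set.mem_univ, true_implies]
    refine ⟨fun ⟨h1, h2⟩ x => ?_, fun h => ⟨by simpa using h j, fun y hy => ?_⟩⟩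
    · split_ifs with h h'
      exacts [h ▸ h1, h2 x h', trivial]
    · simpa [hy, ne_of_mem_of_not_mem hy hj] using h y
  rw [this, Measure.pi_pi, ← Finset.mul_prod_erase _ _ (Finset.mem_univ j), if_pos rfl]
  congr 1
  rw [← Finset.prod_const]
  symm
  refine Finset.prod_subset_one_on_sdiff (fun x hx => ?_) (fun x hx => ?_) (fun x hx => ?_)
  · simpa using ne_of_mem_of_not_mem hx hj
  · simp only [Finset.mem_sdiff, Finset.mem_erase] at hx
    simp [hx.1.1, hx.2]
  · simp [hx, ne_of_mem_of_not_mem hx hj]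

lemma toMeasure_eq_pi_geomPMF {μ : PMF (ι → ℕ)}
    (hμ : ∀ g, μ g = ∏ j, (1 / 2 : ℝ≥0∞) ^ (g j + 1)) :
    μ.toMeasure = Measure.pi fun _ : ι => geomPMF.toMeasure := by
  refine Measure.ext_of_singleton fun g => ?_
  rw [PMF.toMeasure_apply_singleton _ _ (measurableSet_singleton g), Measure.pi_singleton, hμ]
  refine Finset.prod_congr rfl fun j _ => ?_
  rw [PMF.toMeasure_apply_singleton _ _ (measurableSet_singleton _), geomPMF_apply]

/-- The expected number of rank records of rank less than `N`, where a record `x` of rank `m` is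
required to dominate `S x`, in the sense that all ranks in `S x` are less than `c m`. -/
lemma tsum_mul_card_records_le {μ : PMF (ι → ℕ)}
    (hμ : ∀ g, μ g = ∏ j, (1 / 2 : ℝ≥0∞) ^ (g j + 1)) (s : Finset ι) (S : ι → Finset ι)
    (hS : ∀ x, x ∉ S x) (hinj : Set.InjOn (fun x => (S x).card) s) (N : ℕ) (c : ℕ → ℕ) :
    ∑' g, μ g * ((s.filter fun x => g x < N ∧ ∀ y ∈ S x, g y < c (g x)).card : ℝ≥0∞) ≤
      ∑ m ∈ Finset.range N, (1 / 2 : ℝ≥0∞) ^ (m + 1) * ((1 / 2 : ℝ≥0∞) ^ c m)⁻¹ := by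
  let E : ℕ → ι → Set (ι → ℕ) := fun m x =>
    {g | g x ∈ ({m} : Set ℕ) ∧ ∀ y ∈ S x, g y ∈ Set.Iio (c m)}
  have hcard (g : ι → ℕ) :
      ((s.filter fun x => g x < N ∧ ∀ y ∈ S x, g y < c (g x)).card : ℝ≥0∞) =
        ∑ m ∈ Finset.range N, ∑ x ∈ s, (E m x).indicator 1 g := by
    rw [Finset.card_eq_sum_card_fiberwise (f := g) (t := Finset.range N)
      (fun x hx => by simpa using (Finset.mem_filter.1 hx).2.1)]
    rw [Nat.cast_sum]
    refine Finset.sum_congr rfl fun m hm => ?_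
    rw [Finset.filter_filter, Finset.card_filter, Nat.cast_sum]
    refine Finset.sum_congr rfl fun x _ => ?_
    rw [Set.indicator_apply, Nat.cast_ite]
    have : (((g x < N ∧ ∀ y ∈ S x, g y < c (g x)) ∧ g x = m) ↔ g ∈ E m x) := by
      simp only [E, Set.mem_ofPred_eq, Set.mem_singleton_iff, Set.mem_Iio]
      have := Finset.mem_range.1 hm
      constructor
      · rintro ⟨⟨_, h⟩, rfl⟩
        exact ⟨rfl, h⟩
      · rintro ⟨rfl, h⟩
        exact ⟨⟨this, h⟩, rfl⟩
    simp [this]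
  have hE (m : ℕ) (x : ι) : ∑' g, μ g * (E m x).indicator 1 g =
      (1 / 2 : ℝ≥0∞) ^ (m + 1) * geomPMF.toMeasure (Set.Iio (c m)) ^ (S x).card := by
    have h1 : μ.toMeasure (E m x) = ∑' g, μ g * (E m x).indicator 1 g := by
      rw [PMF.toMeasure_apply (hs := (Set.to_countable _).measurableSet)]
      refine tsum_congr fun g => ?_
      by_cases hg : g ∈ E m x <;> simp [hg]
    rw [← h1, toMeasure_eq_pi_geomPMF hμ, pi_setOf_eval_eq_and_forall_mem (hS x),
      PMF.toMeasure_apply_singleton _ _ (measurableSet_singleton _), geomPMF_apply]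
  rw [tsum_congr fun g => by rw [hcard g, Finset.mul_sum]]
  simp_rw [Finset.mul_sum]
  rw [Summable.tsum_finsetSum fun _ _ => ENNReal.summable]
  refine Finset.sum_le_sum fun m _ => ?_
  rw [Summable.tsum_finsetSum fun _ _ => ENNReal.summable]
  simp_rw [hE]
  rw [← Finset.mul_sum]
  gcongr
  rw [← one_sub_geomPMF_Iio, ← ENNReal.tsum_geometric,
    ← Finset.sum_image (f := fun t => geomPMF.toMeasure (Set.Iio (c m)) ^ t) hinj]
  exact ENNReal.sum_le_tsum _

end Geometric

lemma ZTree.isZipTree.zipSpineCount_le_records {n : ℕ} {i : Fin n} {v : ℕ}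
    {g : {j : Fin n // j ≠ i} → ℕ} {t : ZTree ℕ} (ht : t.isZipTree)
    (hn : t.nodes.Perm ((List.finRange n).map
      fun j : Fin n => ((j : ℕ), if h : j = i then v else g ⟨j, h⟩))) :
    t.zipSpineCount (i : ℕ) ≤
      ((Finset.univ.filter fun x : {j : Fin n // j ≠ i} => x.1 < i).filter fun x => g x < v ∧
        ∀ y ∈ Finset.univ.filter (fun y => x < y ∧ y.1 < i), g y < g x + 1).card +
      ((Finset.univ.filter fun x : {j : Fin n // j ≠ i} => i < x.1).filter fun x => g x < v + 1 ∧
        ∀ y ∈ Finset.univ.filter (fun y => y < x ∧ i < y.1), g y < g x).card := by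
  have hmem (p : ℕ × ℕ) : p ∈ t.nodes ↔
      p = ((i : ℕ), v) ∨ ∃ x : {j : Fin n // j ≠ i}, p = ((x.1 : ℕ), g x) := by
    rw [hn.mem_iff]
    simp only [List.mem_map, List.mem_finRange, true_and]
    constructor
    · rintro ⟨j, rfl⟩
      by_cases h : j = i
      · left; simp [h]
      · right; exact ⟨⟨j, h⟩, by simp [h]⟩
    · rintro (rfl | ⟨x, rfl⟩)
      · exact ⟨i, by simp⟩
      · exact ⟨x.1, by simp [x.2]⟩
  refine (ht.zipSpineCount_le (v := v) fun p hp hpi => ?_).trans (Nat.add_le_add ?_ ?_)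
  · rcases (hmem p).1 hp with rfl | ⟨x, rfl⟩
    · rfl
    · exact absurd (Fin.ext hpi) x.2
  all_goals
    refine (Finset.card_le_card fun p hp => ?_).trans
      (Finset.card_image_le (f := fun x : {j : Fin n // j ≠ i} => ((x.1 : ℕ), g x)))
    simp only [Finset.mem_filter, List.mem_toFinset] at hp
    obtain ⟨hp, hlt, hle, hrec⟩ := hp
    obtain rfl | ⟨x, rfl⟩ := (hmem p).1 hp
    · exact absurd hlt (lt_irrefl _)
    refine Finset.mem_image.2 ⟨x, ?_, rfl⟩
    simp only [Finset.mem_filter, Finset.mem_univ, true_and]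
    refine ⟨hlt, by omega, fun y hy => ?_⟩
    have := hrec ((y.1 : ℕ), g y) ((hmem _).2 (.inr ⟨y, rfl⟩))
  · exact Nat.lt_succ_of_le (this hy.1 hy.2)
  · exact this hy.2 hy.1

/-- **Expected number of nodes on the unzipped/zipped paths (Theorem 3, expectation
part).** Let `k ∈ ℕ`, let `i` be a fixed index in `Fin n`, let the ranks `r j` for
`j ≠ i` be independent geometric random variables with `P(r j = m) = 1/2^(m+1)`
(modelled by the product PMF `μ` on `{j // j ≠ i} → ℕ`), and let the rank of `i` be a
fixed value `v ≤ k`. Let `T g` be the (unique) zip tree on nodes with keys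
`0, …, n−1` and these ranks. Then the expected total number of nodes on the right
spine of the left subtree of node `i` together with the left spine of the right
subtree of node `i` is at most `(3/2)·k + 1/2`. -/
theorem expected_zip_path_nodes (n k : ℕ) (i : Fin n) (v : ℕ) (hv : v ≤ k)
    (μ : PMF (({j : Fin n // j ≠ i}) → ℕ))
    (hμ : ∀ g : {j : Fin n // j ≠ i} → ℕ,
        μ g = ∏ j : {j : Fin n // j ≠ i}, (1 / 2 : ℝ≥0∞) ^ (g j + 1))
    (T : ({j : Fin n // j ≠ i} → ℕ) → ZTree ℕ)
    (hT : ∀ g : {j : Fin n // j ≠ i} → ℕ, (T g).isZipTree ∧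
        (T g).nodes.Perm ((List.finRange n).map
          fun j : Fin n => ((j : ℕ), if h : j = i then v else g ⟨j, h⟩))) :
    ∑' g : {j : Fin n // j ≠ i} → ℕ,
        μ g * (((T g).zipSpineCount (i : ℕ) : ℕ) : ℝ≥0∞) ≤
      ENNReal.ofReal ((3 / 2) * (k : ℝ) + 1 / 2) := by
  have hleft := tsum_mul_card_records_le hμ
    (Finset.univ.filter fun x : {j : Fin n // j ≠ i} => x.1 < i)
    (fun x => Finset.univ.filter fun y => x < y ∧ y.1 < i) (by simp)
    (by
      refine StrictAntiOn.injOn fun x hx y hy hxy => Finset.card_lt_card ?_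
      refine Finset.ssubset_iff_of_subset (fun z hz => ?_) |>.2 ⟨y, ?_, by simp⟩
      · simp only [Finset.mem_filter, Finset.mem_univ, true_and] at hz ⊢
        exact ⟨hxy.trans hz.1, hz.2⟩
      · simpa [hxy] using hy) v (fun m => m + 1)
  have hright := tsum_mul_card_records_le hμ
    (Finset.univ.filter fun x : {j : Fin n // j ≠ i} => i < x.1)
    (fun x => Finset.univ.filter fun y => y < x ∧ i < y.1) (by simp)
    (by
      refine StrictMonoOn.injOn fun x hx y hy hxy => Finset.card_lt_card ?_
      refine Finset.ssubset_iff_of_subset (fun z hz => ?_) |>.2 ⟨x, ?_, by simp⟩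
      · simp only [Finset.mem_filter, Finset.mem_univ, true_and] at hz ⊢
        exact ⟨hz.1.trans hxy, hz.2⟩
      · simpa [hxy] using hx) (v + 1) (fun m => m)
  have hhalf (m : ℕ) : (1 / 2 : ℝ≥0∞) ^ m * ((1 / 2 : ℝ≥0∞) ^ m)⁻¹ = 1 :=
    ENNReal.mul_inv_cancel (by simp) (by simp)
  have hhalf' (m : ℕ) : (1 / 2 : ℝ≥0∞) ^ (m + 1) * ((1 / 2 : ℝ≥0∞) ^ m)⁻¹ = 1 / 2 := by
    rw [pow_succ', mul_assoc, hhalf, mul_one]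
  simp only [hhalf, hhalf', Finset.sum_const, Finset.card_range, nsmul_eq_mul] at hleft hright
  calc
    _ ≤ (v : ℝ≥0∞) * 1 + ((v + 1 : ℕ) : ℝ≥0∞) * (1 / 2) := by
      refine le_trans ?_ (add_le_add hleft hright)
      rw [← ENNReal.tsum_add]
      refine ENNReal.tsum_le_tsum fun g => ?_
      rw [← mul_add, ← Nat.cast_add]
      refine mul_le_mul_right (Nat.cast_le.2 ?_) _
      refine ((hT g).1.zipSpineCount_le_records (hT g).2).trans_eq ?_
      congr!
    _ = ENNReal.ofReal ((3 / 2) * (v : ℝ) + 1 / 2) := by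
      rw [show (3 / 2) * (v : ℝ) + 1 / 2 = (v : ℝ) * 1 + ((v + 1 : ℕ) : ℝ) * (1 / 2) by
        push_cast; ring, ENNReal.ofReal_add (by positivity) (by positivity),
        ENNReal.ofReal_mul (by positivity), ENNReal.ofReal_mul (by positivity),
        ENNReal.ofReal_natCast, ENNReal.ofReal_natCast, ENNReal.ofReal_one,
        ENNReal.ofReal_div_of_pos two_pos, ENNReal.ofReal_one, ENNReal.ofReal_ofNat]
    _ ≤ _ := by gcongr
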